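/- (Theorem 2, embedding version) Let ℰ be a continuous signature and K a quasivariety of topological ℰ-algebras. Let X be a subspace of a topological space Y with inclusion map e : X → Y, and let (F(X), i_X) and (F(Y), i_Y) be free universal algebras of X and Y in K. Suppose that X is an HM-valued retract of Y and that HM(F(X)), with the Hartman–Mycielski topology and the pointwise operations inherited from F(X), belongs to K. Then the unique continuous homomorphism F(e) : F(X) → F(Y) with F(e) ∘ i_X = i_Y ∘ e is a topological embedding. -/

import Mathlib

open Set MeasureTheory Topology

universe u v

namespace HMPaper

abbrev I01 : Set ℝ := Set.Ico (0:ℝ) 1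

def IsStep {X : Type u} (f : I01 → X) : Prop :=
  ∃ (n : ℕ) (a : Fin (n + 1) → ℝ), a 0 = 0 ∧ a (Fin.last n) = 1 ∧ StrictMono a ∧
    ∀ (i : Fin n) (s t : I01), (s : ℝ) ∈ Set.Ico (a i.castSucc) (a i.succ) →
      (t : ℝ) ∈ Set.Ico (a i.castSucc) (a i.succ) → f s = f t

def HM (X : Type u) : Type u := {f : I01 → X // IsStep f}

theorem isStep_const {X : Type u} (x : X) : IsStep (fun _ : I01 => x) := by
  refine ⟨1, ![0, 1], rfl, rfl, ?_, fun i s t _ _ => rfl⟩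
  intro i j hij
  fin_cases i <;> fin_cases j <;> simp_all

def hmConst {X : Type u} (x : X) : HM X := ⟨fun _ => x, isStep_const x⟩

theorem isStep_comp {X : Type u} {Y : Type v} (p : X → Y) {f : I01 → X}
    (hf : IsStep f) : IsStep (fun t => p (f t)) := by
  obtain ⟨n, a, h0, h1, hm, hc⟩ := hf
  exact ⟨n, a, h0, h1, hm, fun i s t hs ht => congrArg p (hc i s t hs ht)⟩

def hmMap {X : Type u} {Y : Type v} (p : X → Y) (f : HM X) : HM Y :=
  ⟨fun t => p (f.1 t), isStep_comp p f.2⟩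

/-- The basic set `N(a,b,V,ε)` of the Hartman–Mycielski topology: all step functions `g`
with `λ {t ∈ [a,b) : g(t) ∉ V} < ε` (`λ` being Lebesgue measure). -/
def hmBasicSet {X : Type u} (a b : ℝ) (V : Set X) (ε : ℝ) : Set (HM X) :=
  {g : HM X | MeasureTheory.volume
    {t : ℝ | ∃ ht : t ∈ I01, t ∈ Set.Ico a b ∧ g.1 ⟨t, ht⟩ ∉ V} < ENNReal.ofReal ε}

/-- The neighborhood subbase of the Hartman–Mycielski topology at a step function `f`:
all sets `N(a,b,V,ε)` where `0 ≤ a < b ≤ 1`, `f` is constant on `[a,b)`, `V` is a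
neighborhood of `f(a)` and `ε > 0`. -/
def hmSubbasis {X : Type u} [TopologicalSpace X] (f : HM X) : Set (Set (HM X)) :=
  {S | ∃ (a b : ℝ) (ha : 0 ≤ a) (hab : a < b) (hb : b ≤ 1) (V : Set X) (ε : ℝ),
    0 < ε ∧
    (∀ s t : I01, (s : ℝ) ∈ Set.Ico a b → (t : ℝ) ∈ Set.Ico a b → f.1 s = f.1 t) ∧
    V ∈ nhds (f.1 ⟨a, ha, hab.trans_le hb⟩) ∧
    S = hmBasicSet a b V ε}

/-- The Hartman–Mycielski topology on `HM X`: the topology whose neighborhood filter at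
each `f` is generated by the neighborhood subbase `hmSubbasis f`. -/
instance hmTopologicalSpace (X : Type u) [TopologicalSpace X] : TopologicalSpace (HM X) :=
  TopologicalSpace.mkOfNhds fun f => Filter.generate (hmSubbasis f)

theorem exists_mem_cell {n : ℕ} (a : Fin (n + 1) → ℝ) (x : ℝ)
    (h0 : a 0 ≤ x) (h1 : x < a (Fin.last n)) :
    ∃ i : Fin n, a i.castSucc ≤ x ∧ x < a i.succ := by
  classical
  have hne : (Finset.univ.filter (fun i : Fin (n + 1) => a i ≤ x)).Nonempty :=
    ⟨0, by simpa using h0⟩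
  set M := (Finset.univ.filter (fun i : Fin (n + 1) => a i ≤ x)).max' hne with hM
  have hMle : a M ≤ x := by
    have := (Finset.univ.filter (fun i : Fin (n + 1) => a i ≤ x)).max'_mem hne
    simpa using this
  have hMne : M ≠ Fin.last n := by
    intro h
    rw [h] at hMle
    exact absurd h1 (not_lt.2 hMle)
  have hMlt : (M : ℕ) < n := by
    have := Fin.lt_last_iff_ne_last.2 hMne
    simpa [Fin.lt_def] using this
  refine ⟨⟨M, hMlt⟩, ?_, ?_⟩
  · have : (⟨M, hMlt⟩ : Fin n).castSucc = M := by
      simp [Fin.castSucc, Fin.ext_iff]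
    rw [this]; exact hMle
  · by_contra h
    push_neg at h
    have hmem : (⟨M, hMlt⟩ : Fin n).succ ∈
        Finset.univ.filter (fun i : Fin (n + 1) => a i ≤ x) := by
      simp only [Finset.mem_filter, Finset.mem_univ, true_and]
      exact h
    have hle := Finset.le_max' _ _ hmem
    rw [← hM] at hle
    have : (M : ℕ) + 1 ≤ (M : ℕ) := by
      simpa [Fin.le_def] using hle
    omega

theorem isStep_combine {X : Type u} {Y : Type v} {k : ℕ} (f : Fin k → I01 → X)
    (hf : ∀ i, IsStep (f i)) (g : (Fin k → X) → Y) :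
    IsStep (fun t => g (fun i => f i t)) := by
  classical
  choose n a h0 h1 hmono hconst using hf
  set D : Finset ℝ :=
    insert (0:ℝ) (insert 1 (Finset.univ.biUnion fun i : Fin k =>
      Finset.univ.image (a i))) with hD
  have h0D : (0:ℝ) ∈ D := by simp [hD]
  have h1D : (1:ℝ) ∈ D := by simp [hD]
  have hDmem : ∀ x ∈ D, 0 ≤ x ∧ x ≤ 1 := by
    intro x hx
    simp only [hD, Finset.mem_insert, Finset.mem_biUnion, Finset.mem_image,
      Finset.mem_univ, true_and] at hx
    rcases hx with rfl | rfl | ⟨i, j, rfl⟩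
    · norm_num
    · norm_num
    · constructor
      · have := (hmono i).monotone (Fin.zero_le j)
        rw [h0 i] at this; exact this
      · have := (hmono i).monotone (Fin.le_last j)
        rw [h1 i] at this; exact this
  obtain ⟨m, hm⟩ : ∃ m, D.card = m + 1 := by
    have : D.Nonempty := ⟨0, h0D⟩
    have := Finset.card_pos.2 this
    exact ⟨D.card - 1, by omega⟩
  set b : Fin (m + 1) → ℝ := fun j => ((D.orderIsoOfFin hm j : ℝ)) with hb
  have hbmono : StrictMono b := fun i j hij => by
    exact_mod_cast (D.orderIsoOfFin hm).strictMono hij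
  have hbD : ∀ j, b j ∈ D := fun j => (D.orderIsoOfFin hm j).2
  have hbsurj : ∀ x ∈ D, ∃ j, b j = x := by
    intro x hx
    obtain ⟨j, hj⟩ := (D.orderIsoOfFin hm).surjective ⟨x, hx⟩
    exact ⟨j, by rw [hb]; exact congrArg Subtype.val hj⟩
  have hb0 : b 0 = 0 := by
    obtain ⟨j, hj⟩ := hbsurj 0 h0D
    have h1' : b 0 ≤ b j := hbmono.monotone (Fin.zero_le j)
    rw [hj] at h1'
    exact le_antisymm h1' (hDmem _ (hbD 0)).1
  have hb1 : b (Fin.last m) = 1 := by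
    obtain ⟨j, hj⟩ := hbsurj 1 h1D
    have h1' : b j ≤ b (Fin.last m) := hbmono.monotone (Fin.le_last j)
    rw [hj] at h1'
    exact le_antisymm (hDmem _ (hbD _)).2 h1'
  have hcell : ∀ (j : Fin m) (x : ℝ), x ∈ D → b j.castSucc < x → x < b j.succ → False := by
    intro j x hx hlt hlt'
    obtain ⟨l, rfl⟩ := hbsurj x hx
    have h1' : j.castSucc < l := hbmono.lt_iff_lt.1 hlt
    have h2' : l < j.succ := hbmono.lt_iff_lt.1 hlt'
    rw [Fin.lt_def] at h1' h2'
    simp only [Fin.coe_castSucc, Fin.val_succ] at h1' h2'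
    omega
  refine ⟨m, b, hb0, hb1, hbmono, ?_⟩
  intro j s t hs ht
  refine congrArg g (funext fun i => ?_)
  have hs0 : a i 0 ≤ (s : ℝ) := by rw [h0 i]; exact s.2.1
  have hs1 : (s : ℝ) < a i (Fin.last (n i)) := by rw [h1 i]; exact s.2.2
  obtain ⟨idx, hidx1, hidx2⟩ := exists_mem_cell (a i) s hs0 hs1
  have hlowD : a i idx.castSucc ∈ D := by
    simp only [hD, Finset.mem_insert, Finset.mem_biUnion, Finset.mem_image,
      Finset.mem_univ, true_and]
    exact Or.inr (Or.inr ⟨i, idx.castSucc, rfl⟩)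
  have hupD : a i idx.succ ∈ D := by
    simp only [hD, Finset.mem_insert, Finset.mem_biUnion, Finset.mem_image,
      Finset.mem_univ, true_and]
    exact Or.inr (Or.inr ⟨i, idx.succ, rfl⟩)
  have hlow : a i idx.castSucc ≤ b j.castSucc := by
    by_contra h
    push_neg at h
    exact hcell j _ hlowD h (lt_of_le_of_lt hidx1 hs.2)
  have hup : b j.succ ≤ a i idx.succ := by
    by_contra h
    push_neg at h
    exact hcell j _ hupD (lt_of_le_of_lt hs.1 hidx2) h
  exact hconst i idx s t ⟨hidx1, hidx2⟩
    ⟨le_trans hlow ht.1, lt_of_lt_of_le ht.2 hup⟩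

/-! ### Universal topological algebras of continuous signature -/

/-- A topological `ℰ`-algebra (the algebraic data): a topological space together with
operations `eₙ : Eₙ × Xⁿ → X`.  Continuity of the operations is expressed by
`ContinuousOps`. -/
structure EAlg (E : ℕ → Type u) [∀ n, TopologicalSpace (E n)] : Type (u + 1) where
  carrier : Type u
  top : TopologicalSpace carrier
  ops : ∀ n : ℕ, E n × (Fin n → carrier) → carrier

attribute [instance] EAlg.top

variable {E : ℕ → Type u} [∀ n, TopologicalSpace (E n)]

/-- The algebraic operations of `A` are all continuous, i.e. `A` is a topological
`ℰ`-algebra in the sense of Choban. -/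
def ContinuousOps (A : EAlg E) : Prop := ∀ n : ℕ, Continuous (A.ops n)

/-- A homomorphism of `ℰ`-algebras. -/
def IsHom (A B : EAlg E) (h : A.carrier → B.carrier) : Prop :=
  ∀ (n : ℕ) (c : E n) (x : Fin n → A.carrier),
    h (A.ops n (c, x)) = B.ops n (c, fun i => h (x i))

/-- `(F, i)` is a free universal `ℰ`-algebra of the space `X` in the class `K`. -/
def IsFreeAlg (K : EAlg E → Prop) (X : Type u) [TopologicalSpace X]
    (F : EAlg E) (i : X → F.carrier) : Prop :=
  K F ∧ Continuous i ∧
    ∀ B : EAlg E, K B → ∀ f : X → B.carrier, Continuous f →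
      ∃! h : F.carrier → B.carrier,
        Continuous h ∧ IsHom F B h ∧ ∀ x, h (i x) = f x

/-- `S` is (the underlying set of) a subalgebra of `A`. -/
def IsSubalgebra (A : EAlg E) (S : Set A.carrier) : Prop :=
  ∀ (n : ℕ) (c : E n) (x : Fin n → A.carrier), (∀ i, x i ∈ S) → A.ops n (c, x) ∈ S

/-- The subalgebra of `A` on a closed-under-operations subset `S`, with the subspace
topology. -/
def Subalg (A : EAlg E) (S : Set A.carrier) (hS : IsSubalgebra A S) : EAlg E where
  carrier := S
  top := inferInstance
  ops := fun n p => ⟨A.ops n (p.1, fun i => (p.2 i : A.carrier)),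
    hS n p.1 _ fun i => (p.2 i).2⟩

/-- The Cartesian product of a family of `ℰ`-algebras, with the product topology and
pointwise operations. -/
def ProdAlg {ι : Type u} (A : ι → EAlg E) : EAlg E where
  carrier := ∀ i, (A i).carrier
  top := inferInstance
  ops := fun n p i => (A i).ops n (p.1, fun j => p.2 j i)

/-- A quasivariety: a class of `ℰ`-algebras closed under subalgebras and arbitrary
Cartesian products. -/
def IsQuasivariety (K : EAlg E → Prop) : Prop :=
  (∀ (A : EAlg E) (S : Set A.carrier) (hS : IsSubalgebra A S), K A → K (Subalg A S hS)) ∧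
  (∀ (ι : Type u) (A : ι → EAlg E), (∀ i, K (A i)) → K (ProdAlg A))

/-- A complete quasivariety: a quasivariety containing every completely regular
`ℰ`-algebra algebraically isomorphic to one of its members. -/
def IsCompleteQuasivariety (K : EAlg E → Prop) : Prop :=
  IsQuasivariety K ∧
  ∀ A B : EAlg E, K B → CompletelyRegularSpace A.carrier →
    (∃ h : A.carrier → B.carrier, Function.Bijective h ∧ IsHom A B h) → K A

/-- The pointwise operations on `HM X` induced from operations on `X`. -/
def hmOps {X : Type u} (e : ∀ n : ℕ, E n × (Fin n → X) → X) (n : ℕ)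
    (p : E n × (Fin n → HM X)) : HM X :=
  ⟨fun t => e n (p.1, fun i => (p.2 i).1 t),
    isStep_combine (fun i => (p.2 i).1) (fun i => (p.2 i).2) (fun v => e n (p.1, v))⟩

/-- The Hartman–Mycielski algebra `HM(A)` of an `ℰ`-algebra `A`: step functions with
the Hartman–Mycielski topology and pointwise operations. -/
def HMAlg (A : EAlg E) : EAlg E where
  carrier := HM A.carrier
  top := hmTopologicalSpace A.carrier
  ops := hmOps A.ops

/-- A stratifiable space: a regular space with a monotone stratification `G`. -/
def Stratifiable (X : Type u) [TopologicalSpace X] : Prop :=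
  RegularSpace X ∧
  ∃ G : ℕ → Set X → Set X,
    (∀ (n : ℕ) (H : Set X), IsClosed H → IsOpen (G n H) ∧ H ⊆ G n H) ∧
    (∀ H : Set X, IsClosed H → H = ⋂ n : ℕ, closure (G n H)) ∧
    (∀ (n : ℕ) (H K : Set X), IsClosed H → IsClosed K → H ⊆ K → G n H ⊆ G n K)


theorem isOpen_hm_iff {X : Type u} [TopologicalSpace X] {U : Set (HM X)} :
    IsOpen U ↔ ∀ f ∈ U, U ∈ Filter.generate (hmSubbasis f) :=
  Iff.rfl

theorem mem_hmBasicSet_iff {X : Type u} {a b : ℝ} {V : Set X} {ε : ℝ} {g : HM X} :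
    g ∈ hmBasicSet a b V ε ↔ volume {t : ℝ | ∃ ht : t ∈ I01, t ∈ Set.Ico a b ∧ g.1 ⟨t, ht⟩ ∉ V} <
      ENNReal.ofReal ε :=
  Iff.rfl

/-- The step functions that stay in `W` up to measure `η` at the points where `f` lies in the
interior of `W` form a member of the neighborhood filter generated at `f`. -/
theorem setOf_volume_lt_mem_generate {X : Type u} [TopologicalSpace X] (f : HM X) (W : Set X)
    {η : ℝ} (hη : 0 < η) :
    {h : HM X | volume {t : ℝ | ∃ ht : t ∈ I01, W ∈ 𝓝 (f.1 ⟨t, ht⟩) ∧ h.1 ⟨t, ht⟩ ∉ W}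
      < ENNReal.ofReal η} ∈ Filter.generate (hmSubbasis f) := by
  obtain ⟨n, a, h0, h1, hmono, hconst⟩ := f.2
  have hδ : 0 < η / (n + 1) := by positivity
  have ha0 : ∀ j, 0 ≤ a j := fun j => h0 ▸ hmono.monotone (Fin.zero_le j)
  have ha1 : ∀ j, a j ≤ 1 := fun j => h1 ▸ hmono.monotone (Fin.le_last j)
  have hlt : ∀ i : Fin n, a i.castSucc < a i.succ := fun i => hmono i.castSucc_lt_succ
  have hmem : ∀ i : Fin n, a i.castSucc ∈ I01 :=
    fun i => ⟨ha0 _, (hlt i).trans_le (ha1 _)⟩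
  have hcell : (⋂ i : Fin n, {h : HM X | W ∈ 𝓝 (f.1 ⟨a i.castSucc, hmem i⟩) →
      h ∈ hmBasicSet (a i.castSucc) (a i.succ) W (η / (n + 1))}) ∈
      Filter.generate (hmSubbasis f) := by
    refine Filter.iInter_mem.2 fun i => ?_
    by_cases hW : W ∈ 𝓝 (f.1 ⟨a i.castSucc, hmem i⟩)
    · simp only [hW, true_imp_iff, Set.ofPred_mem_eq]
      exact Filter.mem_generate_of_mem
        ⟨_, _, ha0 _, hlt i, ha1 _, W, _, hδ, hconst i, hW, rfl⟩
    · simp [hW]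
  refine Filter.mem_of_superset hcell fun h hh => ?_
  rw [Set.mem_iInter] at hh
  let bad : Fin n → Set ℝ := fun i => {t | W ∈ 𝓝 (f.1 ⟨a i.castSucc, hmem i⟩) ∧
    ∃ ht : t ∈ I01, t ∈ Set.Ico (a i.castSucc) (a i.succ) ∧ h.1 ⟨t, ht⟩ ∉ W}
  have hbad : ∀ i, volume (bad i) ≤ ENNReal.ofReal (η / (n + 1)) := by
    intro i
    by_cases hW : W ∈ 𝓝 (f.1 ⟨a i.castSucc, hmem i⟩)
    · exact (measure_mono fun t ht => ht.2).trans (le_of_lt (hh i hW))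
    · have : bad i = ∅ := Set.eq_empty_of_forall_notMem fun t ht => hW ht.1
      simp [this]
  have hsub : {t : ℝ | ∃ ht : t ∈ I01, W ∈ 𝓝 (f.1 ⟨t, ht⟩) ∧ h.1 ⟨t, ht⟩ ∉ W} ⊆
      ⋃ i, bad i := by
    rintro t ⟨ht, hW, hnot⟩
    obtain ⟨i, hi⟩ := exists_mem_cell a t (h0 ▸ ht.1) (h1 ▸ ht.2)
    have heq := hconst i ⟨t, ht⟩ ⟨_, hmem i⟩ hi ⟨le_rfl, hlt i⟩
    exact Set.mem_iUnion.2 ⟨i, heq ▸ hW, ht, hi, hnot⟩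
  calc volume _ ≤ volume (⋃ i, bad i) := measure_mono hsub
    _ ≤ ∑ i, volume (bad i) := measure_iUnion_fintype_le _ _
    _ ≤ ∑ _i : Fin n, ENNReal.ofReal (η / (n + 1)) := Finset.sum_le_sum fun i _ => hbad i
    _ = ENNReal.ofReal (n * (η / (n + 1))) := by
      rw [Finset.sum_const, Finset.card_univ, Fintype.card_fin, nsmul_eq_mul,
        ENNReal.ofReal_mul (Nat.cast_nonneg n), ENNReal.ofReal_natCast]
    _ < ENNReal.ofReal η := by
      rw [ENNReal.ofReal_lt_ofReal_iff hη, ← mul_div_assoc, div_lt_iff₀ (by positivity)]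
      linarith

theorem hmBasicSet_mem_generate {X : Type u} [TopologicalSpace X] (f : HM X) {a b : ℝ}
    {W : Set X} (hW : ∀ t : I01, (t : ℝ) ∈ Set.Ico a b → W ∈ 𝓝 (f.1 t)) {ε : ℝ} (hε : 0 < ε) :
    hmBasicSet a b W ε ∈ Filter.generate (hmSubbasis f) :=
  Filter.mem_of_superset (setOf_volume_lt_mem_generate f W hε) fun _ hh => by
    refine (measure_mono ?_).trans_lt hh
    rintro t ⟨ht, hab, hnot⟩
    exact ⟨ht, hW ⟨t, ht⟩ hab, hnot⟩

theorem isOpen_hmBasicSet {X : Type u} [TopologicalSpace X] {a b : ℝ} {V : Set X}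
    (hV : IsOpen V) (ε : ℝ) : IsOpen (hmBasicSet a b V ε) := by
  refine isOpen_hm_iff.2 fun g hg => ?_
  obtain ⟨η, -, hη, hlt⟩ := ENNReal.lt_iff_exists_real_btwn.1 (tsub_pos_of_lt (mem_hmBasicSet_iff.1 hg))
  refine Filter.mem_of_superset
    (setOf_volume_lt_mem_generate g V (ENNReal.ofReal_pos.1 hη)) fun h hh => ?_
  refine (measure_mono (t := {t : ℝ | ∃ ht : t ∈ I01, t ∈ Set.Ico a b ∧ g.1 ⟨t, ht⟩ ∉ V} ∪
    {t : ℝ | ∃ ht : t ∈ I01, V ∈ 𝓝 (g.1 ⟨t, ht⟩) ∧ h.1 ⟨t, ht⟩ ∉ V}) ?_).trans_lt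
    ((measure_union_le _ _).trans_lt ?_)
  · rintro t ⟨ht, hab, hnot⟩
    by_cases hgt : g.1 ⟨t, ht⟩ ∈ V
    · exact Or.inr ⟨ht, hV.mem_nhds hgt, hnot⟩
    · exact Or.inl ⟨ht, hab, hgt⟩
  · rw [add_comm]
    exact lt_tsub_iff_right.1 (lt_trans hh hlt)

theorem continuous_hmMap {X : Type u} {Y : Type v} [TopologicalSpace X] [TopologicalSpace Y]
    {p : X → Y} (hp : Continuous p) : Continuous (hmMap p) := by
  refine continuous_def.2 fun U hU => isOpen_hm_iff.2 fun f hf => ?_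
  have hle : Filter.map (hmMap p) (Filter.generate (hmSubbasis f)) ≤
      Filter.generate (hmSubbasis (hmMap p f)) := by
    refine Filter.le_generate_iff.2 ?_
    rintro _ ⟨a, b, ha, hab, hb, V, ε, hε, hc, hV, rfl⟩
    refine hmBasicSet_mem_generate f (W := p ⁻¹' V) (fun t ht => hp.continuousAt ?_) hε
    rw [hc _ t ⟨le_rfl, hab⟩ ht] at hV
    exact hV
  exact hle (isOpen_hm_iff.1 hU _ hf)

theorem continuous_hmConst {X : Type u} [TopologicalSpace X] :
    Continuous (hmConst : X → HM X) := by
  refine continuous_def.2 fun U hU => isOpen_iff_mem_nhds.2 fun x hx => ?_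
  have hle : Filter.map hmConst (𝓝 x) ≤ Filter.generate (hmSubbasis (hmConst x)) := by
    refine Filter.le_generate_iff.2 ?_
    rintro _ ⟨a, b, ha, hab, hb, V, ε, hε, hc, hV, rfl⟩
    refine Filter.mem_map.2 (Filter.mem_of_superset (show V ∈ 𝓝 x from hV) fun y hy => ?_)
    rw [Set.mem_preimage, mem_hmBasicSet_iff]
    simpa [hmConst, hy] using hε
  exact hle (isOpen_hm_iff.1 hU _ hx)

theorem hmConst_mem_hmBasicSet_iff {X : Type u} {x : X} {V : Set X} :
    hmConst x ∈ hmBasicSet 0 1 V 1 ↔ x ∈ V := by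
  rw [mem_hmBasicSet_iff]
  by_cases hx : x ∈ V
  · simp [hmConst, hx]
  · have : {t : ℝ | ∃ ht : t ∈ I01, t ∈ Set.Ico (0 : ℝ) 1 ∧ (hmConst x).1 ⟨t, ht⟩ ∉ V} =
        Set.Ico 0 1 := by
      ext t
      exact ⟨fun h => h.1, fun h => ⟨h, h, hx⟩⟩
    rw [this]
    simp [hx]

theorem isEmbedding_hmConst {X : Type u} [TopologicalSpace X] :
    IsEmbedding (hmConst : X → HM X) := by
  refine ⟨isInducing_iff_nhds.2 fun x => le_antisymm
    continuous_hmConst.continuousAt.le_comap fun V hV => ?_, fun x y h => ?_⟩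
  · obtain ⟨W, hWV, hW, hxW⟩ := mem_nhds_iff.1 hV
    exact ⟨hmBasicSet 0 1 W 1,
      (isOpen_hmBasicSet hW 1).mem_nhds (hmConst_mem_hmBasicSet_iff.2 hxW),
      fun y hy => hWV (hmConst_mem_hmBasicSet_iff.1 hy)⟩
  · exact congrFun (congrArg Subtype.val h) ⟨0, by norm_num⟩

theorem isHom_hmConst (A : EAlg E) :
    IsHom A (HMAlg A) hmConst :=
  fun _ _ _ => rfl

/-- (Theorem 2, embedding version) Let `K` be a quasivariety of topological
`ℰ`-algebras, `X` a subspace of `Y` which is an `HM`-valued retract of `Y`, and suppose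
`HM(F(X)) ∈ K`.  Then the induced homomorphism `F(e) : F(X) → F(Y)` is a topological
embedding. -/
theorem theorem2_embedding {E : ℕ → Type u} [∀ n, TopologicalSpace (E n)]
    (K : EAlg E → Prop) (hK : IsQuasivariety K) (hKtop : ∀ A, K A → ContinuousOps A)
    (Y : Type u) [TopologicalSpace Y] (X : Set Y)
    (FX : EAlg E) (iX : X → FX.carrier) (hFX : IsFreeAlg K X FX iX)
    (FY : EAlg E) (iY : Y → FY.carrier) (hFY : IsFreeAlg K Y FY iY)
    (r : Y → HM X) (hr : Continuous r) (hret : ∀ x : X, r x = hmConst x)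
    (hHMF : K (HMAlg FX))
    (Fe : FX.carrier → FY.carrier)
    (hFe : Continuous Fe ∧ IsHom FX FY Fe ∧ ∀ x : X, Fe (iX x) = iY x) :
    Topology.IsEmbedding Fe := by
  obtain ⟨hFec, hFeh, hFei⟩ := hFe
  obtain ⟨h, ⟨hc, hh, hi⟩, -⟩ :=
    hFY.2.2 (HMAlg FX) hHMF (fun y => hmMap iX (r y)) ((continuous_hmMap hFX.2.1).comp hr)
  have hcomp : h ∘ Fe = hmConst := by
    refine (hFX.2.2 (HMAlg FX) hHMF (fun x => hmConst (iX x))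
      (continuous_hmConst.comp hFX.2.1)).unique ⟨hc.comp hFec, fun n c x => ?_, fun x => ?_⟩
      ⟨continuous_hmConst, isHom_hmConst FX, fun _ => rfl⟩
    · exact (congrArg h (hFeh n c x)).trans (hh n c _)
    · rw [Function.comp_apply, hFei, hi, hret]
      rfl
  refine IsEmbedding.of_comp hFec hc ?_
  rw [hcomp]
  exact isEmbedding_hmConst

end HMPaper
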